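/- Let f_1,...,f_n, g_1,...,g_n ∈ ℂ[t_1,...,t_m] with g = g_1···g_n. Then the ideal H = ⟨1 − t·g, g_1 x_1 − f_1, ..., g_n x_n − f_n⟩ in ℂ[x_1,...,x_n, t_1,...,t_m, t] equals the kernel of the ring homomorphism ψ: ℂ[x_1,...,x_n,t_1,...,t_m,t] → ℂ(t_1,...,t_m) defined by x_i ↦ f_i/g_i, t_j ↦ t_j, t ↦ 1/g. In particular, H is a prime ideal. -/

import Mathlib

open MvPolynomial Finset

/-- The ring homomorphism `ψ : ℂ[x₁,…,xₙ,t₁,…,tₘ,t] → ℂ(t₁,…,tₘ)` sending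
`x_i ↦ f_i/g_i`, `t_j ↦ t_j` and `t ↦ 1/(g₁⋯gₙ)`.  The variables are indexed by
`Fin n ⊕ (Fin m ⊕ Unit)`: `Sum.inl i` is `x_i`, `Sum.inr (Sum.inl j)` is `t_j`, and
`Sum.inr (Sum.inr ())` is `t`. -/
noncomputable def psi {n m : ℕ} (f g : Fin n → MvPolynomial (Fin m) ℂ) :
    MvPolynomial (Fin n ⊕ (Fin m ⊕ Unit)) ℂ →+* FractionRing (MvPolynomial (Fin m) ℂ) :=
  MvPolynomial.eval₂Hom
    ((algebraMap (MvPolynomial (Fin m) ℂ) (FractionRing (MvPolynomial (Fin m) ℂ))).comp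
      (MvPolynomial.C))
    (fun v => match v with
      | Sum.inl i => algebraMap (MvPolynomial (Fin m) ℂ) _ (f i)
          / algebraMap (MvPolynomial (Fin m) ℂ) _ (g i)
      | Sum.inr (Sum.inl j) => algebraMap (MvPolynomial (Fin m) ℂ) _ (MvPolynomial.X j)
      | Sum.inr (Sum.inr _) => 1 / algebraMap (MvPolynomial (Fin m) ℂ) _ (∏ i, g i))

/-- The ideal `H = ⟨1 − t·g, g₁x₁ − f₁, …, gₙxₙ − fₙ⟩` in `ℂ[x₁,…,xₙ,t₁,…,tₘ,t]`,
where `g = g₁⋯gₙ`. -/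
noncomputable def Hideal {n m : ℕ} (f g : Fin n → MvPolynomial (Fin m) ℂ) :
    Ideal (MvPolynomial (Fin n ⊕ (Fin m ⊕ Unit)) ℂ) :=
  Ideal.span ({1 - X (Sum.inr (Sum.inr ())) * rename (Sum.inr ∘ Sum.inl) (∏ i, g i)} ∪
    Set.range (fun i => rename (Sum.inr ∘ Sum.inl) (g i) * X (Sum.inl i)
      - rename (Sum.inr ∘ Sum.inl) (f i)))

lemma psi_rename {n m : ℕ} (f g : Fin n → MvPolynomial (Fin m) ℂ)
    (q : MvPolynomial (Fin m) ℂ) :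
    psi f g (rename (Sum.inr ∘ Sum.inl) q) =
      algebraMap (MvPolynomial (Fin m) ℂ) (FractionRing (MvPolynomial (Fin m) ℂ)) q := by
  induction q using MvPolynomial.induction_on with
  | C a => simp [psi]
  | add p q hp hq => rw [map_add, map_add, map_add, hp, hq]
  | mul_X p j hp => rw [map_mul, map_mul, map_mul, hp]; simp [psi]

lemma Hideal_le_ker {n m : ℕ} (f g : Fin n → MvPolynomial (Fin m) ℂ)
    (hg : ∀ i, g i ≠ 0) : Hideal f g ≤ RingHom.ker (psi f g) := by
  have hinj := IsFractionRing.injective (MvPolynomial (Fin m) ℂ)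
    (FractionRing (MvPolynomial (Fin m) ℂ))
  have hne : ∀ q : MvPolynomial (Fin m) ℂ, q ≠ 0 →
      algebraMap (MvPolynomial (Fin m) ℂ) (FractionRing (MvPolynomial (Fin m) ℂ)) q ≠ 0 :=
    fun q hq h => hq (hinj (by rw [h, map_zero]))
  unfold Hideal
  rw [Ideal.span_le]
  rintro p (hp | ⟨i, rfl⟩)
  · rw [Set.mem_singleton_iff] at hp
    subst hp
    have h := hne _ (Finset.prod_ne_zero_iff.mpr (fun i (_ : i ∈ Finset.univ) => hg i))
    have hX : psi f g (X (Sum.inr (Sum.inr ()))) =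
        1 / algebraMap (MvPolynomial (Fin m) ℂ) _ (∏ i, g i) := by
      unfold psi
      rw [coe_eval₂Hom, eval₂_X]
    rw [SetLike.mem_coe, RingHom.mem_ker, map_sub, map_mul, map_one, psi_rename, hX,
      one_div, inv_mul_cancel₀ h, sub_self]
  · have h := hne _ (hg i)
    have hX : psi f g (X (Sum.inl i)) = algebraMap (MvPolynomial (Fin m) ℂ) _ (f i)
          / algebraMap (MvPolynomial (Fin m) ℂ) _ (g i) := by
      unfold psi
      rw [coe_eval₂Hom, eval₂_X]
    rw [SetLike.mem_coe, RingHom.mem_ker, map_sub, map_mul, psi_rename, psi_rename, hX,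
      mul_div_cancel₀ _ h, sub_self]

lemma mk_t {n m : ℕ} (f g : Fin n → MvPolynomial (Fin m) ℂ) :
    Ideal.Quotient.mk (Hideal f g) (rename (Sum.inr ∘ Sum.inl) (∏ i, g i)) *
      Ideal.Quotient.mk (Hideal f g) (X (Sum.inr (Sum.inr ()))) = 1 := by
  rw [← map_mul, mul_comm, ← map_one (Ideal.Quotient.mk (Hideal f g)), eq_comm,
    Ideal.Quotient.eq]
  exact Ideal.subset_span (Or.inl rfl)

lemma mk_x {n m : ℕ} (f g : Fin n → MvPolynomial (Fin m) ℂ) (i : Fin n) :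
    Ideal.Quotient.mk (Hideal f g) (rename (Sum.inr ∘ Sum.inl) (g i)) *
      Ideal.Quotient.mk (Hideal f g) (X (Sum.inl i)) =
    Ideal.Quotient.mk (Hideal f g) (rename (Sum.inr ∘ Sum.inl) (f i)) := by
  rw [← map_mul, Ideal.Quotient.eq]
  exact Ideal.subset_span (Or.inr ⟨i, rfl⟩)

lemma clear_var {n m : ℕ} (f g : Fin n → MvPolynomial (Fin m) ℂ)
    (v : Fin n ⊕ (Fin m ⊕ Unit)) : ∃ r : MvPolynomial (Fin m) ℂ,
    Ideal.Quotient.mk (Hideal f g) (rename (Sum.inr ∘ Sum.inl) (∏ i, g i)) *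
      Ideal.Quotient.mk (Hideal f g) (X v) =
    Ideal.Quotient.mk (Hideal f g) (rename (Sum.inr ∘ Sum.inl) r) := by
  rcases v with i | j | u
  · refine ⟨(∏ k ∈ Finset.univ.erase i, g k) * f i, ?_⟩
    rw [← Finset.prod_erase_mul _ _ (Finset.mem_univ i), map_mul, map_mul, mul_assoc, mk_x,
      map_mul, map_mul]
  · refine ⟨(∏ k, g k) * X j, ?_⟩
    rw [map_mul, map_mul, rename_X]
    rfl
  · exact ⟨1, by rw [mk_t, map_one, map_one]⟩

lemma clear_all {n m : ℕ} (f g : Fin n → MvPolynomial (Fin m) ℂ)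
    (p : MvPolynomial (Fin n ⊕ (Fin m ⊕ Unit)) ℂ) :
    ∃ (k : ℕ) (q : MvPolynomial (Fin m) ℂ),
    Ideal.Quotient.mk (Hideal f g) (rename (Sum.inr ∘ Sum.inl) (∏ i, g i)) ^ k *
      Ideal.Quotient.mk (Hideal f g) p =
    Ideal.Quotient.mk (Hideal f g) (rename (Sum.inr ∘ Sum.inl) q) := by
  induction p using MvPolynomial.induction_on with
  | C a => exact ⟨0, C a, by rw [pow_zero, one_mul, rename_C]⟩
  | add p p' hp hp' =>
    obtain ⟨k, q, h⟩ := hp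
    obtain ⟨k', q', h'⟩ := hp'
    refine ⟨k + k', (∏ i, g i) ^ k' * q + (∏ i, g i) ^ k * q', ?_⟩
    simp only [map_add, map_mul (rename _), map_pow (rename _), map_mul (Ideal.Quotient.mk _),
      map_pow (Ideal.Quotient.mk _), ← h, ← h']
    ring
  | mul_X p v hp =>
    obtain ⟨k, q, h⟩ := hp
    obtain ⟨r, hr⟩ := clear_var f g v
    refine ⟨k + 1, q * r, ?_⟩
    rw [map_mul (rename _), map_mul (Ideal.Quotient.mk _), map_mul (Ideal.Quotient.mk _),
      ← h, ← hr]
    ring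

lemma ker_le_Hideal {n m : ℕ} (f g : Fin n → MvPolynomial (Fin m) ℂ)
    (hg : ∀ i, g i ≠ 0) : RingHom.ker (psi f g) ≤ Hideal f g := by
  intro p hp
  obtain ⟨k, q, h⟩ := clear_all f g p
  have hq : q = 0 := by
    have h1 := h
    rw [← map_pow, ← map_mul, Ideal.Quotient.eq] at h1
    have h2 := Hideal_le_ker f g hg h1
    rw [RingHom.mem_ker] at h2 hp
    rw [map_sub, map_mul, hp, mul_zero, psi_rename, zero_sub, neg_eq_zero] at h2
    exact IsFractionRing.injective (MvPolynomial (Fin m) ℂ)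
      (FractionRing (MvPolynomial (Fin m) ℂ)) (by rw [h2, map_zero])
  rw [hq, map_zero, map_zero] at h
  rw [← Ideal.Quotient.eq_zero_iff_mem]
  have hu := (IsUnit.of_mul_eq_one _ (mk_t f g)).pow k
  exact hu.mul_right_eq_zero.mp h

/-- The ideal `H = ⟨1 − t·g, g₁x₁ − f₁, …, gₙxₙ − fₙ⟩` equals the kernel of the ring
homomorphism `ψ : ℂ[x₁,…,xₙ,t₁,…,tₘ,t] → ℂ(t₁,…,tₘ)`, `x_i ↦ f_i/g_i`, `t_j ↦ t_j`,
`t ↦ 1/g`.  In particular, `H` is a prime ideal. -/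
theorem Hideal_eq_ker_psi {n m : ℕ} (f g : Fin n → MvPolynomial (Fin m) ℂ)
    (hg : ∀ i, g i ≠ 0) :
    Hideal f g = RingHom.ker (psi f g) ∧ (Hideal f g).IsPrime := by
  have h : Hideal f g = RingHom.ker (psi f g) :=
    le_antisymm (Hideal_le_ker f g hg) (ker_le_Hideal f g hg)
  refine ⟨h, ?_⟩
  rw [h]
  exact RingHom.ker_isPrime _
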